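/- Assume additionally that the time average of the dilution rate converges: lim_{t→∞} (1/t) ∫₀ᵗ d(r) dr = D̄, and that ν + D̄ ξ*_l > c. Let (s, x, ξ) : [0, ∞) → ℝ³ be a C¹ solution of the transformed random chemostat system with s(0) ≥ 0, x(0) ≥ 0 and ξ(0) ∈ (0,1). Then lim_{t→∞} x(t) = 0; that is, the total microbial biomass (and hence each of the two species x₁ = ξ x and x₂ = (1−ξ) x) becomes extinct, and the attracting set for the full system reduces to the deterministic segment [z*_l/c, z*_u/c] × {0} × {0}. -/

import Mathlib

open Real Filter intervalIntegral

/-- If `f 0 ≥ 0` and `f' ≥ K f` wherever `f < 0`, then `f` stays nonnegative. -/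
lemma nonneg_of_barrier (f f' : ℝ → ℝ) (K T : ℝ) (h0 : 0 ≤ f 0)
    (hf : ∀ t ∈ Set.Icc (0:ℝ) T, HasDerivAt f (f' t) t)
    (hb : ∀ t ∈ Set.Icc (0:ℝ) T, f t < 0 → K * f t ≤ f' t) :
    ∀ t ∈ Set.Icc (0:ℝ) T, 0 ≤ f t := by
  have hE : ∀ t : ℝ, HasDerivAt (fun t => exp (-K * t)) (exp (-K * t) * (-K)) t := by
    intro t
    simpa using ((hasDerivAt_id t).const_mul (-K)).exp
  have hh : ∀ t ∈ Set.Icc (0:ℝ) T, HasDerivAt (fun t => -(f t * exp (-K * t)))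
      (-(f' t * exp (-K * t) + f t * (exp (-K * t) * (-K)))) t :=
    fun t ht => ((hf t ht).mul (hE t)).neg
  have key : ∀ ε > 0, ∀ t ∈ Set.Icc (0:ℝ) T, -(f t * exp (-K * t)) ≤ ε * (1 + t) := by
    intro ε hε
    refine image_le_of_deriv_right_lt_deriv_boundary
      (f := fun t => -(f t * exp (-K * t))) (B := fun t => ε * (1 + t)) (B' := fun _ => ε)
      (f' := fun t => -(f' t * exp (-K * t) + f t * (exp (-K * t) * (-K))))
      (fun t ht => (hh t ht).continuousAt.continuousWithinAt)
      (fun t ht => (hh t (Set.Ico_subset_Icc_self ht)).hasDerivWithinAt) ?_ ?_ ?_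
    · simp; linarith
    · intro t
      simpa using ((hasDerivAt_id t).const_add 1).const_mul ε
    · intro t ht he
      have hpos := exp_pos (-K * t)
      have h1 : 0 < ε * (1 + t) := mul_pos hε (by linarith [ht.1])
      have hneg : f t < 0 := by
        by_contra hcon
        push Not at hcon
        have := mul_nonneg hcon hpos.le
        linarith
      have h2 := hb t (Set.Ico_subset_Icc_self ht) hneg
      have h3 := mul_nonneg (sub_nonneg.2 h2) hpos.le
      nlinarith
  intro t ht
  by_contra hcon
  push Not at hcon
  have hpos := exp_pos (-K * t)
  have h1 : 0 < -(f t * exp (-K * t)) := by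
    have := mul_neg_of_neg_of_pos hcon hpos
    linarith
  have ht1 : 0 < 1 + t := by linarith [ht.1]
  have h2 := key (-(f t * exp (-K * t)) / (2 * (1 + t))) (by positivity) t ht
  have h3 : -(f t * exp (-K * t)) / (2 * (1 + t)) * (1 + t) = -(f t * exp (-K * t)) / 2 := by
    field_simp
  linarith



/-- extinction of the total biomass when `ν + Dbar ξ*_l > c`. -/
theorem chemostat_transformed_extinction
    (s_in a m c b ν r₁ r₂ b₁ b₂ : ℝ)
    (hs_in : 0 < s_in) (ha : 0 < a) (hc : 0 < c) (hcm : c ≤ m)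
    (hb : 0 < b) (hb1 : b ≤ 1) (hν : 0 < ν) (hr₁ : 0 < r₁) (hr₂ : 0 < r₂)
    (hb₁ : 0 < b₁) (hb₁₂ : b₁ ≤ b₂)
    (d : ℝ → ℝ) (hd_cont : Continuous d)
    (hd_bounds : ∀ t, b₁ ≤ d t ∧ d t ≤ b₂)
    (ξl : ℝ) (hξl : ξl = r₂ / (b₂ + r₁ + r₂))
    (Dbar : ℝ)
    (havg : Tendsto (fun t => (1 / t) * ∫ r in (0:ℝ)..t, d r) atTop (nhds Dbar))
    (hcond : ν + Dbar * ξl > c)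
    (s x ξ : ℝ → ℝ)
    (h0 : 0 ≤ s 0 ∧ 0 ≤ x 0 ∧ ξ 0 ∈ Set.Ioo (0:ℝ) 1)
    (hs : ∀ t ∈ Set.Ici (0:ℝ), HasDerivAt s
      (d t * (s_in - s t) - (m * s t / (a + s t)) * x t + b * ν * (ξ t * x t)) t)
    (hx : ∀ t ∈ Set.Ici (0:ℝ), HasDerivAt x
      (-ν * x t - d t * (ξ t * x t) + (c * s t / (a + s t)) * x t) t)
    (hξ : ∀ t ∈ Set.Ici (0:ℝ), HasDerivAt ξ
      (-d t * (ξ t * (1 - ξ t)) - r₁ * ξ t + r₂ * (1 - ξ t)) t) :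
    Tendsto x atTop (nhds 0) := by

  obtain ⟨hs0, hx0, hξ0⟩ := h0
  have hIcc : ∀ {T t : ℝ}, t ∈ Set.Icc (0:ℝ) T → t ∈ Set.Ici (0:ℝ) := fun h => h.1
  -- ξ is nonnegative
  have hξn : ∀ t, 0 ≤ t → 0 ≤ ξ t := by
    intro t ht
    refine nonneg_of_barrier ξ _ 0 t hξ0.1.le (fun u hu => hξ u (hIcc hu)) ?_ t ⟨ht, le_rfl⟩
    intro u _ hn
    have h1 : 0 < d u := lt_of_lt_of_le hb₁ (hd_bounds u).1
    have h2 : 0 < d u * (-ξ u * (1 - ξ u)) :=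
      mul_pos h1 (mul_pos (by linarith) (by linarith))
    have h3 : 0 < r₁ * (-ξ u) := mul_pos hr₁ (by linarith)
    have h4 : 0 < r₂ * (1 - ξ u) := mul_pos hr₂ (by linarith)
    nlinarith
  -- ξ is at most one
  have hξ1 : ∀ t, 0 ≤ t → ξ t ≤ 1 := by
    intro t ht
    have hcont : ContinuousOn ξ (Set.Icc 0 t) :=
      fun u hu => (hξ u (hIcc hu)).continuousAt.continuousWithinAt
    obtain ⟨M, hM⟩ := isCompact_Icc.bddAbove_image hcont
    have hM' : ∀ u ∈ Set.Icc (0:ℝ) t, ξ u ≤ M := fun u hu => hM ⟨u, hu, rfl⟩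
    have := nonneg_of_barrier (fun u => 1 - ξ u) _ (b₂ * M) t (by linarith [hξ0.2])
      (fun u hu => (hξ u (hIcc hu)).const_sub 1) ?_ t ⟨ht, le_rfl⟩
    · linarith
    intro u hu hn
    have h1 : 0 < d u := lt_of_lt_of_le hb₁ (hd_bounds u).1
    have h2 : d u * ξ u ≤ b₂ * M :=
      mul_le_mul (hd_bounds u).2 (hM' u hu) (hξn u hu.1) (by linarith)
    have h3 : 0 ≤ (b₂ * M - d u * ξ u) * (-(1 - ξ u)) :=
      mul_nonneg (by linarith) (by linarith)
    have h4 : 0 ≤ r₁ * ξ u := mul_nonneg hr₁.le (hξn u hu.1)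
    have h5 : 0 ≤ r₂ * (-(1 - ξ u)) := mul_nonneg hr₂.le (by linarith)
    nlinarith
  -- lower bound on ξ
  set k : ℝ := b₂ + r₁ + r₂ with hk
  have hkpos : 0 < k := by linarith
  have hξlpos : 0 < ξl := by rw [hξl]; positivity
  have hkξ : k * ξl = r₂ := by rw [hξl]; field_simp
  have hE : ∀ t : ℝ, HasDerivAt (fun t => exp (-k * t)) (exp (-k * t) * (-k)) t := by
    intro t
    simpa using ((hasDerivAt_id t).const_mul (-k)).exp
  have hξlow : ∀ t, 0 ≤ t → ξl - ξl * exp (-k * t) ≤ ξ t := by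
    intro t ht
    have := nonneg_of_barrier (fun u => ξ u - ξl + ξl * exp (-k * u)) _ (-k) t
      (by simp; exact hξ0.1.le)
      (fun u hu => ((hξ u (hIcc hu)).sub_const ξl).add ((hE u).const_mul ξl)) ?_ t ⟨ht, le_rfl⟩
    · linarith
    intro u hu _
    have h1 : 0 < d u := lt_of_lt_of_le hb₁ (hd_bounds u).1
    have h2 : d u * ξ u ≤ b₂ * ξ u := mul_le_mul_of_nonneg_right (hd_bounds u).2 (hξn u hu.1)
    have h3 : 0 ≤ d u * (ξ u * ξ u) :=
      mul_nonneg h1.le (mul_self_nonneg _)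
    have h4 : k * ξ u = b₂ * ξ u + r₁ * ξ u + r₂ * ξ u := by rw [hk]; ring
    nlinarith
  -- conditional nonnegativity of x and s
  have hxcond : ∀ T, (∀ u ∈ Set.Icc (0:ℝ) T, 0 < a + s u) →
      ∀ u ∈ Set.Icc (0:ℝ) T, 0 ≤ x u := by
    intro T hT
    refine nonneg_of_barrier x _ c T hx0 (fun u hu => hx u (hIcc hu)) ?_
    intro u hu hn
    have h1 : 0 < d u := lt_of_lt_of_le hb₁ (hd_bounds u).1
    have h2 : c * s u / (a + s u) ≤ c := by
      rw [div_le_iff₀ (hT u hu)]; nlinarith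
    have h3 : 0 ≤ d u * ξ u := mul_nonneg h1.le (hξn u hu.1)
    have h4 : 0 ≤ (c - (c * s u / (a + s u)) + ν + d u * ξ u) * (-x u) :=
      mul_nonneg (by linarith) (by linarith)
    nlinarith
  have hscond : ∀ T, (∀ u ∈ Set.Icc (0:ℝ) T, 0 < a + s u) →
      ∀ u ∈ Set.Icc (0:ℝ) T, 0 ≤ s u := by
    intro T hT
    refine nonneg_of_barrier s _ 0 T hs0 (fun u hu => hs u (hIcc hu)) ?_
    intro u hu hn
    have hxu := hxcond T hT u hu
    have h1 : 0 < d u := lt_of_lt_of_le hb₁ (hd_bounds u).1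
    have h2 : m * s u / (a + s u) ≤ 0 :=
      div_nonpos_of_nonpos_of_nonneg (mul_nonpos_of_nonneg_of_nonpos (by linarith) hn.le)
        (hT u hu).le
    have h3 : 0 ≤ d u * (s_in - s u) := mul_nonneg h1.le (by linarith)
    have h4 : m * s u / (a + s u) * x u ≤ 0 := mul_nonpos_of_nonpos_of_nonneg h2 hxu
    have h5 : 0 ≤ b * ν * (ξ u * x u) :=
      mul_nonneg (by positivity) (mul_nonneg (hξn u hu.1) hxu)
    linarith
  -- s never reaches -a/2
  have hspos : ∀ t, 0 ≤ t → 0 < a + s t := by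
    intro t ht
    by_contra hcon
    push Not at hcon
    have hcont : ContinuousOn s (Set.Icc 0 t) :=
      fun u hu => (hs u (hIcc hu)).continuousAt.continuousWithinAt
    have hcl : IsClosed (Set.Icc (0:ℝ) t ∩ s ⁻¹' Set.Iic (-a / 2)) :=
      hcont.preimage_isClosed_of_isClosed isClosed_Icc isClosed_Iic
    have hcomp : IsCompact (Set.Icc (0:ℝ) t ∩ s ⁻¹' Set.Iic (-a / 2)) :=
      isCompact_Icc.of_isClosed_subset hcl Set.inter_subset_left
    obtain ⟨T, ⟨hT, hTs⟩, hmin⟩ := hcomp.exists_isLeast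
      ⟨t, ⟨ht, le_rfl⟩, by simp only [Set.mem_preimage, Set.mem_Iic]; linarith⟩
    simp only [Set.mem_preimage, Set.mem_Iic] at hTs
    have hlt : ∀ u ∈ Set.Icc (0:ℝ) t, u < T → -a / 2 < s u := by
      intro u hu huT
      by_contra hcu
      push Not at hcu
      exact absurd (hmin ⟨hu, hcu⟩) (not_le.2 huT)
    have hTpos : 0 < T := by
      rcases hT.1.eq_or_lt with h | h
      · rw [← h] at hTs; linarith
      · exact h
    have hTge : -a / 2 ≤ s T := by
      have htend : Tendsto s (nhdsWithin T (Set.Iio T)) (nhds (s T)) :=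
        (hs T hT.1).continuousAt.tendsto.mono_left nhdsWithin_le_nhds
      refine ge_of_tendsto htend ?_
      filter_upwards [Ioo_mem_nhdsLT hTpos] with u hu
      exact (hlt u ⟨hu.1.le, hu.2.le.trans hT.2⟩ hu.2).le
    have := hscond T (fun u hu => by
      rcases hu.2.eq_or_lt with h | h
      · rw [h]; linarith
      · linarith [hlt u ⟨hu.1, hu.2.trans hT.2⟩ h]) T ⟨hT.1, le_rfl⟩
    linarith
  have hxn : ∀ t, 0 ≤ t → 0 ≤ x t := fun t ht =>
    hxcond t (fun u hu => hspos u hu.1) t ⟨ht, le_rfl⟩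
  -- exponential bound
  set H : ℝ → ℝ := fun t =>
    (c - ν) * t - ξl * (∫ r in (0:ℝ)..t, d r) - (b₂ * ξl / k) * exp (-k * t) with hH
  have hHd : ∀ t, HasDerivAt H (c - ν - ξl * d t + b₂ * ξl * exp (-k * t)) t := by
    intro t
    have hI : HasDerivAt (fun t => ∫ r in (0:ℝ)..t, d r) (d t) t :=
      integral_hasDerivAt_right (hd_cont.intervalIntegrable _ _)
        hd_cont.aestronglyMeasurable.stronglyMeasurableAtFilter hd_cont.continuousAt
    have := (((hasDerivAt_id t).const_mul (c - ν)).sub (hI.const_mul ξl)).sub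
      ((hE t).const_mul (b₂ * ξl / k))
    have hk1 : b₂ * ξl / k * (exp (-k * t) * (-k)) = -(b₂ * ξl * exp (-k * t)) := by
      field_simp
    rw [hk1] at this
    exact this.congr_deriv (by ring)
  have hbound : ∀ t, 0 ≤ t → x t ≤ x 0 * exp (-H 0) * exp (H t) := by
    intro t ht
    have := nonneg_of_barrier (fun u => x 0 * exp (-H 0) - x u * exp (-H u)) _ 0 t (by simp)
      (fun u hu => ((hx u (hIcc hu)).mul (hHd u).neg.exp).const_sub (x 0 * exp (-H 0)))
      ?_ t ⟨ht, le_rfl⟩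
    · have h1 : x t * exp (-H t) * exp (H t) = x t := by
        rw [mul_assoc, ← exp_add]; simp
      have h2 := mul_nonneg this (exp_pos (H t)).le
      nlinarith
    intro u hu _
    have hu0 := hu.1
    have hd0 : 0 < d u := lt_of_lt_of_le hb₁ (hd_bounds u).1
    have hxu := hxn u hu0
    have h2 : c * s u / (a + s u) ≤ c := by
      rw [div_le_iff₀ (hspos u hu0)]; nlinarith
    have h3 : d u * (ξl - ξl * exp (-k * u)) ≤ d u * ξ u :=
      mul_le_mul_of_nonneg_left (hξlow u hu0) hd0.le
    have h4 : d u * (ξl * exp (-k * u)) ≤ b₂ * (ξl * exp (-k * u)) :=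
      mul_le_mul_of_nonneg_right (hd_bounds u).2 (by positivity)
    have h5 : 0 ≤ (c - ν - ξl * d u + b₂ * ξl * exp (-k * u)
        - (-ν - d u * ξ u + c * s u / (a + s u))) * (x u * exp (-H u)) :=
      mul_nonneg (by linarith) (by positivity)
    simp only [zero_mul]
    refine h5.trans (le_of_eq ?_)
    simp only [Pi.neg_apply]
    ring
  have hHbot : Tendsto H atTop atBot := by
    have h1 : Tendsto (fun t : ℝ => (c - ν) - ξl * ((1 / t) * ∫ r in (0:ℝ)..t, d r)) atTop
        (nhds ((c - ν) - ξl * Dbar)) := (havg.const_mul ξl).const_sub _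
    have h2 := h1.neg_mul_atTop (by linarith [mul_comm Dbar ξl]) tendsto_id
    refine tendsto_atBot_mono' _ ?_ h2
    filter_upwards [eventually_gt_atTop 0] with t ht
    have h3 : 0 ≤ (b₂ * ξl / k) * exp (-k * t) := by
      have : 0 ≤ b₂ := by linarith
      positivity
    have h4 : ((c - ν) - ξl * ((1 / t) * ∫ r in (0:ℝ)..t, d r)) * id t
        = (c - ν) * t - ξl * (∫ r in (0:ℝ)..t, d r) := by
      simp only [id]
      field_simp
    rw [h4]
    simp only [hH]
    linarith
  have hlim : Tendsto (fun t => x 0 * exp (-H 0) * exp (H t)) atTop (nhds 0) := by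
    simpa using (tendsto_exp_atBot.comp hHbot).const_mul (x 0 * exp (-H 0))
  refine squeeze_zero' ?_ ?_ hlim
  · filter_upwards [eventually_ge_atTop 0] with t ht using hxn t ht
  · filter_upwards [eventually_ge_atTop 0] with t ht using hbound t ht
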